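/- If a bounded domain Ω ⊂ ℝⁿ is quasihyperbolically well behaved, then Ω has no geodesic loop in the Euclidean closure Ω̄^Euc. -/

import Mathlib

open Metric Set Filter Topology MeasureTheory
open scoped NNReal ENNReal

noncomputable section

variable {E : Type*} [NormedAddCommGroup E] [NormedSpace ℝ E]

/-- The quasihyperbolic length of a path `γ : [a, b] → Ω`, i.e. `∫ ‖γ'(t)‖ / δ_Ω(γ t) dt`. -/
def qhLength (Ω : Set E) (γ : ℝ → E) (a b : ℝ) : ℝ :=
  ∫ t in a..b, ‖deriv γ t‖ / infDist (γ t) Ωᶜ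

/-- Admissible (Lipschitz, i.e. rectifiable) paths joining `x` to `y` inside `Ω`. -/
def qhAdmissible (Ω : Set E) (x y : E) (γ : ℝ → E) (a b : ℝ) : Prop :=
  a ≤ b ∧ γ a = x ∧ γ b = y ∧ (∀ t ∈ Icc a b, γ t ∈ Ω) ∧
    ∃ K : ℝ≥0, LipschitzOnWith K γ (Icc a b)

/-- The quasihyperbolic distance `k_Ω` on a domain `Ω`. -/
def qhDist (Ω : Set E) (x y : E) : ℝ :=
  sInf { L : ℝ | ∃ γ a b, qhAdmissible Ω x y γ a b ∧ L = qhLength Ω γ a b }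

/-- `γ` is a (unit-speed) quasihyperbolic geodesic on the parameter set `s`. -/
def IsQHGeodesicOn (Ω : Set E) (γ : ℝ → E) (s : Set ℝ) : Prop :=
  (∀ t ∈ s, γ t ∈ Ω) ∧ ∀ a ∈ s, ∀ b ∈ s, qhDist Ω (γ a) (γ b) = |a - b|

/-- `Ω` is a QH-visibility domain: any two distinct Euclidean boundary points have
neighbourhoods with disjoint closures together with a compact subset of `Ω` which is met by
every quasihyperbolic geodesic joining the two neighbourhoods. -/
def QHVisibilityDomain (Ω : Set E) : Prop :=
  ∀ p ∈ frontier Ω, ∀ q ∈ frontier Ω, p ≠ q →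
    ∃ U V : Set E, IsOpen U ∧ IsOpen V ∧ p ∈ U ∧ q ∈ V ∧
      closure U ∩ closure V = ∅ ∧
      ∃ K : Set E, IsCompact K ∧ K ⊆ Ω ∧
        ∀ (γ : ℝ → E) (T : ℝ), 0 ≤ T → IsQHGeodesicOn Ω γ (Icc 0 T) →
          γ 0 ∈ U → γ T ∈ V → ∃ t ∈ Icc 0 T, γ t ∈ K

/-- A quasihyperbolic geodesic line. -/
def IsQHGeodesicLine (Ω : Set E) (γ : ℝ → E) : Prop :=
  IsQHGeodesicOn Ω γ univ

/-- `Ω` has no geodesic loop in its Euclidean closure: no quasihyperbolic geodesic line has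
equal cluster sets at `+∞` and `-∞`. -/
def NoGeodesicLoop (Ω : Set E) : Prop :=
  ∀ γ : ℝ → E, IsQHGeodesicLine Ω γ →
    {x : E | MapClusterPt x atTop γ} ≠ {x : E | MapClusterPt x atBot γ}

/-- The quasihyperbolic distance from a point to a set. -/
def qhDistToSet (Ω : Set E) (x : E) (S : Set E) : ℝ :=
  sInf (qhDist Ω x '' S)

/-- `Ω` is quasihyperbolically well behaved: whenever two sequences in `Ω` converge to the
same Euclidean boundary point, the quasihyperbolic distance from any fixed point of `Ω` to
any quasihyperbolic geodesics joining them tends to infinity. -/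
def QHWellBehaved (Ω : Set E) : Prop :=
  ∀ p ∈ frontier Ω, ∀ (x y : ℕ → E) (γ : ℕ → ℝ → E) (a b : ℕ → ℝ),
    (∀ k, x k ∈ Ω) → (∀ k, y k ∈ Ω) →
    Tendsto x atTop (𝓝 p) → Tendsto y atTop (𝓝 p) →
    (∀ k, a k ≤ b k) → (∀ k, IsQHGeodesicOn Ω (γ k) (Icc (a k) (b k))) →
    (∀ k, γ k (a k) = x k) → (∀ k, γ k (b k) = y k) →
    ∀ x₀ ∈ Ω, Tendsto (fun k => qhDistToSet Ω x₀ (γ k '' Icc (a k) (b k))) atTop atTop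

/-- The quasihyperbolic length of a path is nonnegative. -/
lemma qhLength_nonneg {E : Type*} [NormedAddCommGroup E] [NormedSpace ℝ E]
    (Ω : Set E) (γ : ℝ → E) {a b : ℝ} (hab : a ≤ b) : 0 ≤ qhLength Ω γ a b :=
  intervalIntegral.integral_nonneg hab fun _ _ => div_nonneg (norm_nonneg _) infDist_nonneg

/-- The quasihyperbolic distance is at most the length of any admissible path. -/
lemma qhDist_le_qhLength {E : Type*} [NormedAddCommGroup E] [NormedSpace ℝ E]
    {Ω : Set E} {x y : E} {γ : ℝ → E} {a b : ℝ} (h : qhAdmissible Ω x y γ a b) :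
    qhDist Ω x y ≤ qhLength Ω γ a b := by
  refine csInf_le ⟨0, ?_⟩ ⟨γ, a, b, h, rfl⟩
  rintro L ⟨γ', a', b', h', rfl⟩
  exact qhLength_nonneg Ω γ' h'.1

/-- Points in a ball whose double lies in `Ω` are at quasihyperbolic distance at most
`‖y - x‖ / r`, as the length of the segment shows. -/
lemma qhDist_le_of_mem_ball {E : Type*} [NormedAddCommGroup E] [NormedSpace ℝ E]
    {Ω : Set E} {p x y : E} {r : ℝ} (hr : 0 < r) (hball : ball p (2 * r) ⊆ Ω)
    (hx : x ∈ ball p r) (hy : y ∈ ball p r) : qhDist Ω x y ≤ ‖y - x‖ / r := by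
  have hseg (t : ℝ) (ht : t ∈ Icc (0 : ℝ) 1) : AffineMap.lineMap x y t ∈ ball p r :=
    (convex_ball p r).lineMap_mem hx hy ht
  have hadm : qhAdmissible Ω x y (AffineMap.lineMap x y : ℝ → E) 0 1 := by
    refine ⟨zero_le_one, AffineMap.lineMap_apply_zero x y, AffineMap.lineMap_apply_one x y,
      fun t ht => hball (ball_subset_ball (by linarith) (hseg t ht)), nndist x y,
      (lipschitzWith_lineMap x y).lipschitzOnWith⟩
  refine (qhDist_le_qhLength hadm).trans ((le_abs_self _).trans ?_)
  have hbound := intervalIntegral.norm_integral_le_of_norm_le_const (a := 0) (b := 1)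
    (f := fun t : ℝ => ‖deriv (AffineMap.lineMap x y : ℝ → E) t‖ /
      infDist (AffineMap.lineMap x y t : E) Ωᶜ) (C := ‖y - x‖ / r) ?_
  · simpa [qhLength] using hbound
  intro t ht
  rw [uIoc_of_le zero_le_one] at ht
  have hd : deriv (AffineMap.lineMap x y : ℝ → E) t = y - x :=
    AffineMap.hasDerivAt_lineMap.deriv
  rw [Real.norm_of_nonneg (div_nonneg (norm_nonneg _) infDist_nonneg), hd]
  rcases (Ωᶜ).eq_empty_or_nonempty with he | hne
  · rw [he, infDist_empty, div_zero]
    positivity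
  · refine div_le_div_of_nonneg_left (norm_nonneg _) hr ((le_infDist hne).2 fun z hz => ?_)
    by_contra! hlt
    have hm := mem_ball.1 (hseg t ⟨ht.1.le, ht.2⟩)
    refine hz (hball (mem_ball.2 ?_))
    linarith [dist_triangle_left z p (AffineMap.lineMap x y t : E)]

/-- A quasihyperbolic geodesic line does not accumulate at `+∞` at a point of the domain. -/
lemma not_mapClusterPt_atTop_of_isQHGeodesicLine {E : Type*} [NormedAddCommGroup E]
    [NormedSpace ℝ E] {Ω : Set E} (hOpen : IsOpen Ω) {γ : ℝ → E} (hγ : IsQHGeodesicLine Ω γ)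
    {p : E} (hp : p ∈ Ω) : ¬ MapClusterPt p atTop γ := by
  intro hcl
  obtain ⟨ε, hε, hball⟩ := Metric.isOpen_iff.1 hOpen p hp
  have hr : 0 < ε / 2 := half_pos hε
  have hfreq := mapClusterPt_iff_frequently.1 hcl _ (ball_mem_nhds p hr)
  obtain ⟨s, hs⟩ := hfreq.exists
  obtain ⟨t, ht, hst⟩ := (hfreq.and_eventually (eventually_ge_atTop (s + 3))).exists
  have hle := qhDist_le_of_mem_ball (Ω := Ω) hr (by rwa [mul_div_cancel₀ ε two_ne_zero]) hs ht
  rw [hγ.2 s trivial t trivial, le_div_iff₀ hr, ← dist_eq_norm] at hle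
  have h3 : 3 ≤ |s - t| := by
    rw [abs_sub_comm]
    exact (by linarith : (3 : ℝ) ≤ t - s).trans (le_abs_self _)
  have hs' := mem_ball.1 hs
  have ht' := mem_ball.1 ht
  have htri := dist_triangle_right (γ t) (γ s) p
  nlinarith

/-- A point of a quasihyperbolic geodesic line has distance at most `0` to any portion of the
line containing it. -/
lemma qhDistToSet_nonpos_of_mem {E : Type*} [NormedAddCommGroup E] [NormedSpace ℝ E]
    {Ω : Set E} {γ : ℝ → E} (hγ : IsQHGeodesicLine Ω γ) {s : Set ℝ} {t : ℝ} (ht : t ∈ s) :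
    qhDistToSet Ω (γ t) (γ '' s) ≤ 0 := by
  refine csInf_le ⟨0, ?_⟩ ⟨γ t, mem_image_of_mem γ ht, ?_⟩
  · rintro _ ⟨_, ⟨u, -, rfl⟩, rfl⟩
    rw [hγ.2 t trivial u trivial]
    exact abs_nonneg _
  · rw [hγ.2 t trivial t trivial, sub_self, abs_zero]

/-- Every quasihyperbolically well behaved bounded domain `Ω ⊆ ℝⁿ` has no
geodesic loop in the Euclidean closure. -/
theorem statement4 {n : ℕ} (Ω : Set (EuclideanSpace ℝ (Fin n)))
    (hOpen : IsOpen Ω) (hConn : IsConnected Ω) (hBdd : Bornology.IsBounded Ω)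
    (hWB : QHWellBehaved Ω) :
    NoGeodesicLoop Ω := by
  intro γ hγ hEq
  have hcpt : IsCompact (closure Ω) := hBdd.isCompact_closure
  obtain ⟨p, hpcl, hp⟩ := hcpt.exists_mapClusterPt (f := atTop) (u := γ)
    (le_principal_iff.2 (mem_map.2 (Eventually.of_forall fun t => subset_closure (hγ.1 t trivial))))
  have hp' : MapClusterPt p atBot γ := by
    have h : p ∈ {x | MapClusterPt x atTop γ} := hp
    rwa [hEq] at h
  have hpΩ : p ∉ Ω := fun h => not_mapClusterPt_atTop_of_isQHGeodesicLine hOpen hγ h hp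
  have hpfr : p ∈ frontier Ω := ⟨hpcl, by rwa [hOpen.interior_eq]⟩
  have hfar (k : ℕ) : ∃ t : ℝ, 0 ≤ t ∧ dist (γ t) p < 1 / ((k : ℝ) + 1) := by
    obtain ⟨t, ht, h0⟩ := ((mapClusterPt_iff_frequently.1 hp _
      (ball_mem_nhds p (Nat.one_div_pos_of_nat (n := k)))).and_eventually
        (eventually_ge_atTop 0)).exists
    exact ⟨t, h0, ht⟩
  have hnear (k : ℕ) : ∃ t : ℝ, t ≤ 0 ∧ dist (γ t) p < 1 / ((k : ℝ) + 1) := by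
    obtain ⟨t, ht, h0⟩ := ((mapClusterPt_iff_frequently.1 hp' _
      (ball_mem_nhds p (Nat.one_div_pos_of_nat (n := k)))).and_eventually
        (eventually_le_atBot 0)).exists
    exact ⟨t, h0, ht⟩
  choose b hb0 hb using hfar
  choose a ha0 ha using hnear
  have htends {u : ℕ → ℝ} (hu : ∀ k : ℕ, dist (γ (u k)) p < 1 / ((k : ℝ) + 1)) :
      Tendsto (fun k => γ (u k)) atTop (𝓝 p) :=
    tendsto_iff_dist_tendsto_zero.2 <| squeeze_zero (fun _ => dist_nonneg)
      (fun k => (hu k).le) tendsto_one_div_add_atTop_nhds_zero_nat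
  have hlim := hWB p hpfr (fun k => γ (a k)) (fun k => γ (b k)) (fun _ => γ) a b
    (fun _ => hγ.1 _ trivial) (fun _ => hγ.1 _ trivial) (htends ha) (htends hb)
    (fun k => (ha0 k).trans (hb0 k))
    (fun _ => ⟨fun t _ => hγ.1 t trivial, fun s _ t _ => hγ.2 s trivial t trivial⟩)
    (fun _ => rfl) (fun _ => rfl) (γ 0) (hγ.1 0 trivial)
  obtain ⟨k, hk⟩ := (hlim.eventually_ge_atTop 1).exists
  have hle := qhDistToSet_nonpos_of_mem hγ (s := Icc (a k) (b k)) (t := 0) ⟨ha0 k, hb0 k⟩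
  linarith

end
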